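/- For j = 1,2,3 let s_j ∈ [−1/2, 1/2] with s₁ + s₂ + s₃ = 0, and let f_j : [s_j,1] → ℝ be C¹ with f_j' absolutely continuous and f_j'' ∈ L²((s_j,1)). Assume: (i) f₁(s₁) + f₂(s₂) + f₃(s₃) = 0; (ii) f₁'(s₁) = f₂'(s₂) = f₃'(s₃); (iii) |f_j(1)| ≤ β and |f_j'(1)| ≤ β for j = 1,2,3, for some β ≥ 0; and (iv) |f_j'(x)| ≤ 1/2 for all x ∈ [s_j,1] and j = 1,2,3. Set α = ( Σ_{j=1}^{3} ∫_{s_j}^{1} f_j''(x)²·(1 + f_j'(x)²)^{−5/2} dx )^{1/2}. Then 0 ≤ Σ_{j=1}^{3} ∫_{s_j}^{1} √(1 + f_j'(x)²) dx − 3 ≤ (3/2)β² + α·( Σ_{j=1}^{3} ∫_{s_j}^{1} f_j(x)² dx )^{1/2}. -/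

import Mathlib

open MeasureTheory Set

lemma ibp_aux (a : ℝ) (ha : a ≤ 1) (f f' f'' : ℝ → ℝ)
    (hderiv : ∀ x ∈ Icc a 1, HasDerivWithinAt f (f' x) (Icc a 1) x)
    (hf''int : IntervalIntegrable f'' volume a 1)
    (hAC : ∀ x ∈ Icc a 1, f' x = f' a + ∫ y in a..x, f'' y)
    (hgrad : ∀ x ∈ Icc a 1, |f' x| ≤ 1/2) :
    ∫ x in a..1, f x * f'' x = f 1 * f' 1 - f a * f' a - ∫ x in a..1, (f' x) ^ 2 := by
  have hu : uIcc a 1 = Icc a 1 := uIcc_of_le ha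
  have hfAC : AbsolutelyContinuousOnInterval f a 1 := by
    apply LipschitzOnWith.absolutelyContinuousOnInterval (K := 1/2)
    rw [hu]
    apply (convex_Icc a 1).lipschitzOnWith_of_nnnorm_hasDerivWithin_le hderiv
    intro x hx
    rw [← NNReal.coe_le_coe]
    simpa using hgrad x hx
  set G : ℝ → ℝ := fun x => f' a + ∫ y in a..x, f'' y with hG
  have hc : AbsolutelyContinuousOnInterval (fun _ : ℝ => f' a) a 1 := by
    apply LipschitzOnWith.absolutelyContinuousOnInterval (K := 0)
    exact LipschitzWith.const (f' a) |>.lipschitzOnWith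
  have hGAC : AbsolutelyContinuousOnInterval G a 1 :=
    hc.add (hf''int.absolutelyContinuousOnInterval_intervalIntegral left_mem_uIcc)
  have key := hfAC.integral_mul_deriv_eq_deriv_mul hGAC
  have h1 : ∫ x in a..1, f x * deriv G x = ∫ x in a..1, f x * f'' x := by
    apply intervalIntegral.integral_congr_ae
    filter_upwards [hf''int.ae_hasDerivAt_integral] with x hx hxm
    have := (hx (uIoc_subset_uIcc hxm) a left_mem_uIcc).const_add (f' a)
    rw [this.deriv]
  have h2 : ∫ x in a..1, deriv f x * G x = ∫ x in a..1, (f' x) ^ 2 := by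
    apply intervalIntegral.integral_congr_ae
    have : ∀ᵐ x : ℝ, x ≠ 1 := by simp [ae_iff]
    filter_upwards [this] with x hx1 hxm
    rw [uIoc_of_le ha] at hxm
    have hxI : x ∈ Icc a 1 := ⟨hxm.1.le, hxm.2⟩
    have hd := (hderiv x hxI).hasDerivAt (Icc_mem_nhds hxm.1 (lt_of_le_of_ne hxm.2 hx1))
    rw [hd.deriv, hAC x hxI]
    rw [← hAC x hxI, sq]
    congr 1
    exact (hAC x hxI).symm
  rw [h1, h2] at key
  rw [key, hAC 1 ⟨ha, le_rfl⟩]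
  simp [hG]

lemma sqrt_aux (p : ℝ) : Real.sqrt (1 + p ^ 2) ≤ 1 + p ^ 2 / 2 := by
  rw [Real.sqrt_le_left (by positivity)]
  nlinarith [sq_nonneg (p ^ 2)]

lemma weight_aux (p : ℝ) (hp : |p| ≤ 1/2) : (1/4 : ℝ) ≤ (1 + p ^ 2) ^ (-(5:ℝ)/2) := by
  have h1 : p ^ 2 ≤ 1/4 := by
    rw [← sq_abs]; nlinarith [abs_nonneg p]
  have h2 : (1 + p ^ 2) ^ (-(3:ℝ)) ≤ (1 + p ^ 2) ^ (-(5:ℝ)/2) :=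
    Real.rpow_le_rpow_of_exponent_le (by nlinarith [sq_nonneg p]) (by norm_num)
  refine le_trans ?_ h2
  rw [Real.rpow_neg (by positivity)]
  have : (1 + p ^ 2) ^ (3:ℝ) = (1 + p ^ 2) ^ 3 := by
    exact Real.rpow_ofNat (1 + p ^ 2) 3
  rw [this, show (1/4 : ℝ) = 4⁻¹ by norm_num]
  apply inv_anti₀ (by positivity)
  calc (1 + p ^ 2) ^ 3 ≤ (1 + 1/4) ^ 3 := by gcongr
    _ ≤ 4 := by norm_num

lemma quad_aux (a : ℝ) (ha : a ≤ 1) (f f' f'' : ℝ → ℝ)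
    (hf : ContinuousOn f (Icc a 1)) (hf' : ContinuousOn f' (Icc a 1))
    (hf''int : IntervalIntegrable f'' volume a 1)
    (hL2 : IntervalIntegrable (fun x => (f'' x) ^ 2) volume a 1)
    (hgrad : ∀ x ∈ Icc a 1, |f' x| ≤ 1/2) (t : ℝ) :
    0 ≤ (∫ x in a..1, (f x) ^ 2) * (t * t) + (∫ x in a..1, f x * f'' x) * t
      + ∫ x in a..1, (f'' x) ^ 2 * (1 + (f' x) ^ 2) ^ (-(5:ℝ)/2) := by
  have hu : uIcc a 1 = Icc a 1 := uIcc_of_le ha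
  have i1 : IntervalIntegrable (fun x => (f x) ^ 2) volume a 1 :=
    (hu ▸ hf.pow 2 : ContinuousOn _ (uIcc a 1)).intervalIntegrable
  have i2 : IntervalIntegrable (fun x => f x * f'' x) volume a 1 :=
    hf''int.continuousOn_mul (hu ▸ hf)
  have hw : ContinuousOn (fun x => (1 + (f' x) ^ 2) ^ (-(5:ℝ)/2)) (uIcc a 1) := by
    rw [hu]
    apply ContinuousOn.rpow_const (by fun_prop)
    intro x _
    left
    positivity
  have i3 := hL2.mul_continuousOn hw
  rw [← intervalIntegral.integral_mul_const, ← intervalIntegral.integral_mul_const,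
    ← intervalIntegral.integral_add (i1.mul_const _) (i2.mul_const _),
    ← intervalIntegral.integral_add ((i1.mul_const _).add (i2.mul_const _)) i3]
  apply intervalIntegral.integral_nonneg ha
  intro x hx
  have := weight_aux _ (hgrad x hx)
  nlinarith [sq_nonneg (f x * t + f'' x / 2), mul_le_mul_of_nonneg_left this (sq_nonneg (f'' x))]

lemma len_aux (a : ℝ) (ha : a ≤ 1) (f' : ℝ → ℝ) (hf' : ContinuousOn f' (Icc a 1)) :
    1 - a ≤ (∫ x in a..1, Real.sqrt (1 + (f' x) ^ 2)) ∧
    (∫ x in a..1, Real.sqrt (1 + (f' x) ^ 2)) ≤ 1 - a + (∫ x in a..1, (f' x) ^ 2) / 2 := by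
  have hu : uIcc a 1 = Icc a 1 := uIcc_of_le ha
  have hf'u := hf'
  rw [← hu] at hf'u
  have i1 : IntervalIntegrable (fun x => Real.sqrt (1 + (f' x) ^ 2)) volume a 1 :=
    ContinuousOn.intervalIntegrable (by fun_prop)
  have i2 : IntervalIntegrable (fun x => (f' x) ^ 2) volume a 1 :=
    ContinuousOn.intervalIntegrable (by fun_prop)
  have i0 : IntervalIntegrable (fun _ : ℝ => (1:ℝ)) volume a 1 := intervalIntegrable_const
  constructor
  · have := intervalIntegral.integral_mono_on ha i0 i1 (fun x _ => by
      rw [Real.one_le_sqrt]; nlinarith [sq_nonneg (f' x)])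
    simpa using this
  · have := intervalIntegral.integral_mono_on ha i1 (i0.add (i2.div_const 2))
      (fun x _ => sqrt_aux (f' x))
    rw [intervalIntegral.integral_add i0 (i2.div_const 2), intervalIntegral.integral_div] at this
    simpa using this

/-- The length comparison estimate ((4.14)–(4.16), i.e. the graph form of (4.8)) in the
proof of Proposition 4.1: for three C¹ graphs over `[s_j, 1]` with `s₁+s₂+s₃ = 0`,
absolutely continuous derivatives and L² second derivatives, meeting at a single point
at 120° (conditions (i)–(ii)), with endpoint smallness (iii) and gradient bound (iv),
`0 ≤ Σ_j ∫ √(1+f_j'²) − 3 ≤ (3/2)β² + α (Σ_j ∫ f_j²)^{1/2}`. -/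
theorem length_comparison_estimate
    (s : Fin 3 → ℝ) (hs : ∀ j, s j ∈ Icc (-(1/2) : ℝ) (1/2))
    (hs0 : s 0 + s 1 + s 2 = 0)
    (f f' f'' : Fin 3 → ℝ → ℝ) (β : ℝ) (hβ : 0 ≤ β)
    (hf'cont : ∀ j, ContinuousOn (f' j) (Icc (s j) 1))
    (hderiv : ∀ j, ∀ x ∈ Icc (s j) 1, HasDerivWithinAt (f j) (f' j x) (Icc (s j) 1) x)
    (hf''int : ∀ j, IntervalIntegrable (f'' j) volume (s j) 1)
    (hAC : ∀ j, ∀ x ∈ Icc (s j) 1, f' j x = f' j (s j) + ∫ y in (s j)..x, f'' j y)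
    (hL2 : ∀ j, IntervalIntegrable (fun x => (f'' j x) ^ 2) volume (s j) 1)
    (hmeet : f 0 (s 0) + f 1 (s 1) + f 2 (s 2) = 0)
    (hangle : f' 0 (s 0) = f' 1 (s 1) ∧ f' 1 (s 1) = f' 2 (s 2))
    (hend : ∀ j, |f j 1| ≤ β ∧ |f' j 1| ≤ β)
    (hgrad : ∀ j, ∀ x ∈ Icc (s j) 1, |f' j x| ≤ 1/2) :
    0 ≤ (∑ j : Fin 3, ∫ x in (s j)..1, Real.sqrt (1 + (f' j x) ^ 2)) - 3
    ∧ (∑ j : Fin 3, ∫ x in (s j)..1, Real.sqrt (1 + (f' j x) ^ 2)) - 3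
      ≤ (3/2) * β ^ 2
        + Real.sqrt (∑ j : Fin 3, ∫ x in (s j)..1,
            (f'' j x) ^ 2 * (1 + (f' j x) ^ 2) ^ (-(5:ℝ)/2))
          * Real.sqrt (∑ j : Fin 3, ∫ x in (s j)..1, (f j x) ^ 2) := by
  have ha : ∀ j, s j ≤ 1 := fun j => (hs j).2.trans (by norm_num)
  have hL := fun j => len_aux (s j) (ha j) (f' j) (hf'cont j)
  have hfc : ∀ j, ContinuousOn (f j) (Icc (s j) 1) := fun j x hx =>
    (hderiv j x hx).continuousWithinAt
  have hI := fun j => ibp_aux (s j) (ha j) (f j) (f' j) (f'' j) (hderiv j) (hf''int j) (hAC j)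
    (hgrad j)
  have hQ := fun j => quad_aux (s j) (ha j) (f j) (f' j) (f'' j) (hfc j) (hf'cont j)
    (hf''int j) (hL2 j) (hgrad j)
  have hB : ∀ j, f j 1 * f' j 1 ≤ β ^ 2 := fun j => by
    calc f j 1 * f' j 1 ≤ |f j 1 * f' j 1| := le_abs_self _
      _ = |f j 1| * |f' j 1| := abs_mul _ _
      _ ≤ β * β := mul_le_mul (hend j).1 (hend j).2 (abs_nonneg _) hβ
      _ = β ^ 2 := by ring
  have hz : f 0 (s 0) * f' 0 (s 0) + f 1 (s 1) * f' 1 (s 1) + f 2 (s 2) * f' 2 (s 2) = 0 := by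
    rw [hangle.1, hangle.2, ← add_mul, ← add_mul, hmeet, zero_mul]
  have hA0 : 0 ≤ ∑ j : Fin 3, ∫ x in (s j)..1,
      (f'' j x) ^ 2 * (1 + (f' j x) ^ 2) ^ (-(5:ℝ)/2) :=
    Finset.sum_nonneg fun j _ => intervalIntegral.integral_nonneg (ha j) fun x _ => by positivity
  have hD := discrim_le_zero (K := ℝ) (a := ∑ j : Fin 3, ∫ x in (s j)..1, (f j x) ^ 2)
    (b := ∑ j : Fin 3, ∫ x in (s j)..1, f j x * f'' j x)
    (c := ∑ j : Fin 3, ∫ x in (s j)..1, (f'' j x) ^ 2 * (1 + (f' j x) ^ 2) ^ (-(5:ℝ)/2))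
    (fun t => by
      rw [Finset.sum_mul, Finset.sum_mul, ← Finset.sum_add_distrib, ← Finset.sum_add_distrib]
      exact Finset.sum_nonneg fun j _ => hQ j t)
  rw [discrim] at hD
  rw [← Real.sqrt_mul hA0]
  have hX : -(∑ j : Fin 3, ∫ x in (s j)..1, f j x * f'' j x) / 2 ≤
      Real.sqrt ((∑ j : Fin 3, ∫ x in (s j)..1,
            (f'' j x) ^ 2 * (1 + (f' j x) ^ 2) ^ (-(5:ℝ)/2))
          * (∑ j : Fin 3, ∫ x in (s j)..1, (f j x) ^ 2)) := by
    apply Real.le_sqrt_of_sq_le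
    linarith
  have hS : -(∑ j : Fin 3, ∫ x in (s j)..1, f j x * f'' j x) / 2 + (3/2) * β ^ 2 ≥
      (∑ j : Fin 3, ∫ x in (s j)..1, Real.sqrt (1 + (f' j x) ^ 2)) - 3 := by
    simp only [Fin.sum_univ_three]
    linarith [hL 0, hL 1, hL 2, hI 0, hI 1, hI 2, hB 0, hB 1, hB 2,
      (hL 0).2, (hL 1).2, (hL 2).2]
  constructor
  · simp only [Fin.sum_univ_three]
    linarith [(hL 0).1, (hL 1).1, (hL 2).1]
  · linarith
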